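/- Let points X = {x^1,...,x^M} with weights ω_i satisfy an L₂-MZ inequality with constants A, B on V = span{η_k}_{k∈I} (η_k L₂-orthonormal). Suppose a set J of n indices is drawn i.i.d. from {1,...,M} with probabilities ϱ_i ≥ C ω_i Σ_{k∈I}|η_k(x^i)|² / (Σ_j ω_j Σ_{k∈I}|η_k(x^j)|²) where 0 < C ≤ 1. If n ≥ (12B/(AC)) |I| (log|I| + t), then with probability at least 1 − 2e^{−t}, the subsampled weighted points satisfy (A/2)‖f‖_{L₂}² ≤ Σ_{i∈J} (ω_i/(nϱ_i)) |f(x^i)|² ≤ (3B/2)‖f‖_{L₂}² for all f ∈ V. -/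

import Mathlib

open MeasureTheory

section HLP
open Matrix
theorem hlp_trace_pow_comm {n : Type*} [Fintype n] [DecidableEq n] (X Y : Matrix n n ℂ) (k : ℕ) :
    trace ((X * Y) ^ k) = trace ((Y * X) ^ k) := by
  cases k with
  | zero => simp
  | succ k =>
    have h : ∀ k : ℕ, (X * Y) ^ k * X = X * (Y * X) ^ k := by
      intro k
      induction k with
      | zero => simp
      | succ k ih => rw [pow_succ', mul_assoc, ih, pow_succ']; simp only [mul_assoc]
    rw [pow_succ, ← mul_assoc, h, mul_assoc, trace_mul_comm, mul_assoc, ← pow_succ]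
theorem hlp_S {n : Type*} [Fintype n] (X : Matrix n n ℂ) :
    (trace (Xᴴ * X)).re = ∑ i, ∑ j, ‖X i j‖ ^ 2 := by
  simp only [trace, diag, mul_apply, conjTranspose_apply, Complex.re_sum]
  rw [Finset.sum_comm]
  refine Finset.sum_congr rfl fun i _ => Finset.sum_congr rfl fun j _ => ?_
  rw [Complex.sq_norm, Complex.normSq_apply]; simp
theorem hlp_CS {n : Type*} [Fintype n] (X Y : Matrix n n ℂ) :
    ‖trace (X * Y)‖ ^ 2 ≤ (trace (Xᴴ * X)).re * (trace (Yᴴ * Y)).re := by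
  rw [hlp_S, hlp_S]
  have h1 : ‖trace (X * Y)‖ ≤ ∑ p : n × n, ‖X p.1 p.2‖ * ‖Y p.2 p.1‖ := by
    rw [Fintype.sum_prod_type]
    simp only [trace, diag, mul_apply]
    refine (norm_sum_le _ _).trans (Finset.sum_le_sum fun i _ => (norm_sum_le _ _).trans ?_)
    simp
  have h2 := Finset.sum_mul_sq_le_sq_mul_sq Finset.univ (fun p : n × n => ‖X p.1 p.2‖) (fun p => ‖Y p.2 p.1‖)
  rw [Fintype.sum_prod_type (f := fun p : n × n => ‖X p.1 p.2‖ ^ 2), Fintype.sum_prod_type_right (f := fun p : n × n => ‖Y p.2 p.1‖ ^ 2)] at h2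
  exact (pow_le_pow_left₀ (norm_nonneg _) h1 2).trans h2

theorem hlp_CD {n : Type*} [Fintype n] [DecidableEq n] (k : ℕ) :
    (∀ Y : Matrix n n ℂ, ‖trace (Y ^ (2 * 2 ^ k))‖ ≤ (trace ((Yᴴ * Y) ^ (2 ^ k))).re) ∧
    (∀ A B : Matrix n n ℂ, A.IsHermitian → B.IsHermitian → ‖trace ((A * B) ^ (2 ^ k))‖ ^ 2 ≤
      (trace (A ^ (2 * 2 ^ k))).re * (trace (B ^ (2 * 2 ^ k))).re) := by
  induction k with
  | zero =>
    constructor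
    · intro Y
      have h := hlp_CS Y Y
      have h0 : 0 ≤ (trace (Yᴴ * Y)).re := by rw [hlp_S]; positivity
      simp only [pow_zero, mul_one, pow_one, pow_two Y]
      exact abs_le_of_sq_le_sq' (by nlinarith) h0 |>.2
    · intro A B hA hB
      have h := hlp_CS A B
      rw [hA.eq, hB.eq] at h
      simpa [pow_two] using h
  | succ k ih =>
    obtain ⟨C, D⟩ := ih
    constructor
    · intro Y
      have h1 := C (Y ^ 2)
      have e1 : trace (((Y ^ 2)ᴴ * Y ^ 2) ^ 2 ^ k) = trace (((Yᴴ * Y) * (Y * Yᴴ)) ^ 2 ^ k) := by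
        rw [pow_two, conjTranspose_mul, mul_assoc, hlp_trace_pow_comm]
        simp only [mul_assoc]
      have h2 := D (Yᴴ * Y) (Y * Yᴴ) (isHermitian_conjTranspose_mul_self Y) (isHermitian_mul_conjTranspose_self Y)
      rw [hlp_trace_pow_comm Y Yᴴ] at h2
      have h3 : 0 ≤ (trace ((Yᴴ * Y) ^ (2 * 2 ^ k))).re := by
        have : ((Yᴴ * Y) ^ (2 * 2 ^ k)) = ((Yᴴ * Y) ^ (2 ^ k))ᴴ * ((Yᴴ * Y) ^ (2 ^ k)) := by
          rw [conjTranspose_pow, (isHermitian_conjTranspose_mul_self Y).eq, two_mul, pow_add]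
        rw [this, hlp_S]; positivity
      rw [← pow_mul, e1] at h1
      have e2 : 2 * (2 * 2 ^ k) = 2 * 2 ^ (k + 1) := by ring
      have e3 : 2 * 2 ^ k = 2 ^ (k + 1) := by ring
      rw [e2] at h1
      rw [e3] at h2 h3
      refine h1.trans ((Complex.re_le_norm _).trans ?_)
      exact abs_le_of_sq_le_sq' (by nlinarith) h3 |>.2
    · intro A B hA hB
      have h1 := C (A * B)
      have e1 : trace (((A * B)ᴴ * (A * B)) ^ 2 ^ k) = trace ((A ^ 2 * B ^ 2) ^ 2 ^ k) := by
        rw [conjTranspose_mul, hA.eq, hB.eq, mul_assoc, hlp_trace_pow_comm]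
        simp only [pow_two, mul_assoc]
      have h2 := D (A ^ 2) (B ^ 2) (hA.pow 2) (hB.pow 2)
      rw [← pow_mul, ← pow_mul] at h2
      have e2 : 2 * (2 * 2 ^ k) = 2 * 2 ^ (k + 1) := by ring
      have e3 : 2 * 2 ^ k = 2 ^ (k + 1) := by ring
      rw [e2] at h2
      rw [e3, e1] at h1
      refine le_trans ?_ h2
      exact pow_le_pow_left₀ (norm_nonneg _) (h1.trans (Complex.re_le_norm _)) 2

theorem hlp_ALT {n : Type*} [Fintype n] [DecidableEq n] (k : ℕ) :
    ∀ A B : Matrix n n ℂ, A.IsHermitian → B.IsHermitian →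
    (trace ((A * B) ^ (2 ^ k))).re ≤ (trace (A ^ (2 ^ k) * B ^ (2 ^ k))).re := by
  induction k with
  | zero => intro A B _ _; simp
  | succ k ih =>
    intro A B hA hB
    have h1 := (hlp_CD k).1 (A * B)
    have e1 : trace (((A * B)ᴴ * (A * B)) ^ 2 ^ k) = trace ((A ^ 2 * B ^ 2) ^ 2 ^ k) := by
      rw [conjTranspose_mul, hA.eq, hB.eq, mul_assoc, hlp_trace_pow_comm]
      simp only [pow_two, mul_assoc]
    have e3 : 2 * 2 ^ k = 2 ^ (k + 1) := by ring
    have h2 := ih (A ^ 2) (B ^ 2) (hA.pow 2) (hB.pow 2)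
    rw [← pow_mul, ← pow_mul, e3] at h2
    rw [e3, e1] at h1
    exact (Complex.re_le_norm _).trans (h1.trans h2)

open NormedSpace Filter Topology

theorem hlp_pow_sub {𝔸 : Type*} [NormedRing 𝔸] [NormOneClass 𝔸] (U V : 𝔸) (c : ℝ) (hc : 1 ≤ c)
    (hU : ‖U‖ ≤ c) (hV : ‖V‖ ≤ c) (n : ℕ) : ‖U ^ n - V ^ n‖ ≤ n * c ^ n * ‖U - V‖ := by
  induction n with
  | zero => simp
  | succ n ih =>
    have e : U ^ (n+1) - V ^ (n+1) = (U ^ n - V ^ n) * U + V ^ n * (U - V) := by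
      rw [pow_succ, pow_succ]; noncomm_ring
    have h1 : ‖(U ^ n - V ^ n) * U‖ ≤ (n * c ^ n * ‖U - V‖) * c :=
      (norm_mul_le _ _).trans (mul_le_mul ih hU (norm_nonneg _) (by positivity))
    have h2 : ‖V ^ n * (U - V)‖ ≤ c ^ (n+1) * ‖U - V‖ := by
      refine (norm_mul_le _ _).trans (mul_le_mul_of_nonneg_right ?_ (norm_nonneg _))
      exact (norm_pow_le V n).trans ((pow_le_pow_left₀ (norm_nonneg _) hV n).trans (pow_le_pow_right₀ hc (by omega)))
    rw [e]
    refine (norm_add_le _ _).trans ((add_le_add h1 h2).trans (le_of_eq ?_))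
    push_cast; ring

theorem hlp_norm_exp {𝔸 : Type*} [NormedRing 𝔸] [NormOneClass 𝔸] [NormedAlgebra ℝ 𝔸] [CompleteSpace 𝔸]
    (a : 𝔸) : ‖exp a‖ ≤ Real.exp ‖a‖ := by
  rw [congrFun (exp_eq_tsum ℝ) a, Real.exp_eq_exp_ℝ, congrFun (exp_eq_tsum ℝ) ‖a‖]
  have hs := expSeries_summable' (𝕂 := ℝ) (𝔸 := ℝ) ‖a‖
  refine tsum_of_norm_bounded hs.hasSum fun i => ?_
  rw [norm_smul]
  simp only [smul_eq_mul, norm_inv, RCLike.norm_natCast]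
  exact mul_le_mul_of_nonneg_left (norm_pow_le a i) (by positivity)

theorem hlp_trotter {𝔸 : Type*} [NormedRing 𝔸] [NormOneClass 𝔸] [NormedAlgebra ℝ 𝔸] [CompleteSpace 𝔸]
    (a b : 𝔸) : Tendsto (fun k : ℕ => (exp (((2:ℝ) ^ k)⁻¹ • a) * exp (((2:ℝ) ^ k)⁻¹ • b)) ^ (2 ^ k)) atTop
      (𝓝 (exp (a + b))) := by
  have hd : HasDerivAt (fun s : ℝ => exp (s • a) * exp (s • b) - exp (s • (a + b))) 0 0 := by
    have h1 := hasDerivAt_exp_smul_const (𝕂 := ℝ) a (0:ℝ)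
    have h2 := hasDerivAt_exp_smul_const (𝕂 := ℝ) b (0:ℝ)
    have h3 := hasDerivAt_exp_smul_const (𝕂 := ℝ) (a + b) (0:ℝ)
    have h := (h1.mul h2).sub h3
    have e : exp ((0:ℝ) • a) * a * exp ((0:ℝ) • b) + exp ((0:ℝ) • a) * (exp ((0:ℝ) • b) * b)
        - exp ((0:ℝ) • (a + b)) * (a + b) = 0 := by simp
    rw [e] at h
    exact h
  rw [hasDerivAt_iff_tendsto_slope_zero] at hd
  have ht : Tendsto (fun k : ℕ => ((2:ℝ) ^ k)⁻¹) atTop (𝓝[≠] 0) := by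
    refine tendsto_nhdsWithin_iff.2 ⟨?_, Eventually.of_forall fun k => by simp⟩
    exact tendsto_inv_atTop_zero.comp (tendsto_pow_atTop_atTop_of_one_lt (by norm_num))
  have h4 := (hd.comp ht).norm
  simp only [Function.comp_def, zero_add, inv_inv, zero_smul, exp_zero, mul_one, sub_self, sub_zero,
    norm_zero, norm_smul, norm_pow, Real.norm_ofNat] at h4
  rw [tendsto_iff_norm_sub_tendsto_zero]
  have h5 := h4.const_mul (Real.exp (‖a‖ + ‖b‖))
  rw [mul_zero] at h5
  refine squeeze_zero (fun _ => norm_nonneg _) (fun k => ?_) h5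
  set r : ℝ := ((2:ℝ) ^ k)⁻¹ with hr
  have hr0 : 0 < r := by positivity
  have hrn : ‖r‖ = r := by rw [Real.norm_eq_abs, abs_of_pos hr0]
  have e1 : exp (a + b) = (exp (r • (a + b))) ^ (2 ^ k) := by
    let _ : NormedAlgebra ℚ 𝔸 := NormedAlgebra.restrictScalars ℚ ℝ 𝔸
    rw [← NormedSpace.exp_nsmul, ← Nat.cast_smul_eq_nsmul ℝ, smul_smul, hr]
    simp
  rw [e1]
  have hc : 1 ≤ Real.exp (r * (‖a‖ + ‖b‖)) := Real.one_le_exp (by positivity)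
  have hU : ‖exp (r • a) * exp (r • b)‖ ≤ Real.exp (r * (‖a‖ + ‖b‖)) := by
    rw [mul_add, Real.exp_add]
    refine (norm_mul_le _ _).trans (mul_le_mul ((hlp_norm_exp _).trans ?_) ((hlp_norm_exp _).trans ?_)
      (norm_nonneg _) (Real.exp_pos _).le) <;> rw [norm_smul, hrn]
  have hV : ‖exp (r • (a + b))‖ ≤ Real.exp (r * (‖a‖ + ‖b‖)) := by
    refine (hlp_norm_exp _).trans (Real.exp_le_exp.2 ?_)
    rw [norm_smul, hrn]
    exact mul_le_mul_of_nonneg_left (norm_add_le _ _) hr0.le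
  refine (hlp_pow_sub _ _ _ hc hU hV _).trans (le_of_eq ?_)
  rw [← Real.exp_nat_mul]
  have : ((2 ^ k : ℕ) : ℝ) * (r * (‖a‖ + ‖b‖)) = ‖a‖ + ‖b‖ := by
    rw [hr]; push_cast; field_simp
  rw [this]; push_cast; ring

section GT
open scoped Matrix.Norms.Operator
theorem hlp_GT {n : Type*} [Fintype n] [DecidableEq n] [Nonempty n] (A B : Matrix n n ℂ)
    (hA : A.IsHermitian) (hB : B.IsHermitian) :
    (trace (exp (A + B))).re ≤ (trace (exp A * exp B)).re := by
  have h := hlp_trotter A B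
  have hc : Continuous (fun X : Matrix n n ℂ => (trace X).re) :=
    Complex.continuous_re.comp (continuous_id.matrix_trace)
  refine le_of_tendsto ((hc.tendsto _).comp h) (Eventually.of_forall fun k => ?_)
  simp only [Function.comp_def]
  have key : ∀ X : Matrix n n ℂ, exp X = (exp (((2:ℝ)^k)⁻¹ • X)) ^ (2 ^ k) := by
    intro X
    rw [← Matrix.exp_nsmul, ← Nat.cast_smul_eq_nsmul ℝ, smul_smul]
    simp
  have hh : ∀ X : Matrix n n ℂ, X.IsHermitian → (exp (((2:ℝ)^k)⁻¹ • X)).IsHermitian := by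
    intro X hX
    apply IsHermitian.exp
    exact hX.smul (k := ((2:ℝ)^k)⁻¹) (by simp [IsSelfAdjoint])
  rw [key A, key B]
  exact hlp_ALT k _ _ (hh A hA) (hh B hB)
end GT
open scoped ComplexOrder


theorem hlp_spec {n : Type*} [Fintype n] [DecidableEq n] (A : Matrix n n ℂ) (hA : A.IsHermitian) :
    ∃ U : Matrix n n ℂ, U * Uᴴ = 1 ∧ Uᴴ * U = 1 ∧
      A = U * diagonal (fun i => ((hA.eigenvalues i : ℝ) : ℂ)) * Uᴴ ∧
      ∀ θ : ℝ, exp (θ • A) = U * diagonal (fun i => ((Real.exp (θ * hA.eigenvalues i) : ℝ) : ℂ)) * Uᴴ := by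
  have h1 : (hA.eigenvectorUnitary : Matrix n n ℂ) * (hA.eigenvectorUnitary : Matrix n n ℂ)ᴴ = 1 :=
    Unitary.coe_mul_star_self hA.eigenvectorUnitary
  have h2 : (hA.eigenvectorUnitary : Matrix n n ℂ)ᴴ * (hA.eigenvectorUnitary : Matrix n n ℂ) = 1 :=
    Unitary.coe_star_mul_self hA.eigenvectorUnitary
  have h3 : A = (hA.eigenvectorUnitary : Matrix n n ℂ) *
      diagonal (fun i => ((hA.eigenvalues i : ℝ) : ℂ)) * (hA.eigenvectorUnitary : Matrix n n ℂ)ᴴ := by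
    have := hA.spectral_theorem
    rw [Unitary.conjStarAlgAut_apply] at this
    exact this
  refine ⟨hA.eigenvectorUnitary, h1, h2, h3, fun θ => ?_⟩
  set U := (hA.eigenvectorUnitary : Matrix n n ℂ)
  have hinv : U⁻¹ = Uᴴ := inv_eq_right_inv h1
  have hU : IsUnit U := IsUnit.of_mul_eq_one _ h1
  have e : θ • A = U * diagonal (fun i => ((θ * hA.eigenvalues i : ℝ) : ℂ)) * U⁻¹ := by
    rw [hinv]
    conv_lhs => rw [h3]
    rw [← smul_mul_assoc, ← mul_smul_comm, ← diagonal_smul]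
    congr 3
    ext i; simp
  rw [e, exp_conj _ _ hU, hinv, exp_diagonal]
  congr 3
  ext i
  rw [Pi.coe_exp, Complex.ofReal_exp, Complex.exp_eq_exp_ℂ]

theorem hlp_conj_psd {n : Type*} [Fintype n] [DecidableEq n] (U : Matrix n n ℂ) (f : n → ℝ)
    (hf : ∀ i, 0 ≤ f i) : (U * diagonal (fun i => (f i : ℂ)) * Uᴴ).PosSemidef := by
  apply PosSemidef.mul_mul_conjTranspose_same
  apply PosSemidef.diagonal
  intro i
  change (0:ℂ) ≤ (f i : ℂ)
  exact_mod_cast hf i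

theorem hlp_exp_psd {n : Type*} [Fintype n] [DecidableEq n] (A : Matrix n n ℂ) (hA : A.IsHermitian) :
    (exp A).PosSemidef := by
  obtain ⟨U, h1, h2, h3, h4⟩ := hlp_spec A hA
  have := h4 1
  rw [one_smul] at this
  rw [this]
  exact hlp_conj_psd U _ fun i => (Real.exp_pos _).le

theorem hlp_tr_nonneg {n : Type*} [Fintype n] [DecidableEq n] (P Q : Matrix n n ℂ)
    (hP : P.PosSemidef) (hQ : Q.PosSemidef) : 0 ≤ (trace (P * Q)).re := by
  obtain ⟨U, h1, h2, h3, h4⟩ := hlp_spec Q hQ.1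
  have e : Q = (U * diagonal (fun i => ((√(hQ.1.eigenvalues i) : ℝ) : ℂ))) *
      (U * diagonal (fun i => ((√(hQ.1.eigenvalues i) : ℝ) : ℂ)))ᴴ := by
    rw [conjTranspose_mul, diagonal_conjTranspose]
    conv_lhs => rw [h3]
    simp only [mul_assoc]
    rw [← mul_assoc (diagonal _) (diagonal _), diagonal_mul_diagonal]
    congr 3
    ext i
    simp only [Pi.star_apply, RCLike.star_def, Complex.conj_ofReal]
    rw [← Complex.ofReal_mul, Real.mul_self_sqrt (hQ.eigenvalues_nonneg i)]
  set C := (U * diagonal (fun i => ((√(hQ.1.eigenvalues i) : ℝ) : ℂ)))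
  rw [e, ← mul_assoc, trace_mul_comm, ← mul_assoc]
  have := (hP.conjTranspose_mul_mul_same C).trace_nonneg
  exact (Complex.le_def.1 this).1

theorem hlp_small {n : Type*} [Fintype n] [DecidableEq n] (T : Matrix n n ℂ) (hT : T.IsHermitian)
    (h : (trace (exp T)).re < 1) : (-T).PosSemidef := by
  obtain ⟨U, h1, h2, h3, h4⟩ := hlp_spec T hT
  have := h4 1
  rw [one_smul] at this
  rw [this, mul_assoc, trace_mul_comm, mul_assoc, h2, mul_one, trace_diagonal, Complex.re_sum] at h
  simp only [one_mul, Complex.ofReal_re] at h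
  have hneg : ∀ i, 0 ≤ -hT.eigenvalues i := by
    intro i
    by_contra hc
    push Not at hc
    have h5 : Real.exp (hT.eigenvalues i) ≤ ∑ j, Real.exp (hT.eigenvalues j) :=
      Finset.single_le_sum (f := fun j => Real.exp (hT.eigenvalues j)) (fun j _ => (Real.exp_pos _).le) (Finset.mem_univ i)
    have h6 := Real.add_one_le_exp (hT.eigenvalues i)
    linarith
  have e : -T = U * diagonal (fun i => ((-hT.eigenvalues i : ℝ) : ℂ)) * Uᴴ := by
    conv_lhs => rw [h3]
    rw [← neg_mul, ← mul_neg, diagonal_neg]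
    congr 3
    ext i; simp
  rw [e]
  exact hlp_conj_psd U _ hneg

theorem hlp_exp_bound {n : Type*} [Fintype n] [DecidableEq n] (X : Matrix n n ℂ) (hX : X.PosSemidef)
    (R : ℝ) (hR : (trace X).re ≤ R) (θ g : ℝ)
    (hg : ∀ u : ℝ, 0 ≤ u → u ≤ R → Real.exp (θ * u) ≤ 1 + g * u) :
    (1 + g • X - exp (θ • X)).PosSemidef := by
  obtain ⟨U, h1, h2, h3, h4⟩ := hlp_spec X hX.1
  have hle : ∀ i, hX.1.eigenvalues i ≤ R := by
    intro i
    refine le_trans ?_ hR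
    rw [hX.1.trace_eq_sum_eigenvalues, Complex.re_sum]
    exact Finset.single_le_sum (f := fun j => hX.1.eigenvalues j) (fun j _ => hX.eigenvalues_nonneg j) (Finset.mem_univ i)
  have e : 1 + g • X - exp (θ • X) = U * diagonal (fun i =>
      ((1 + g * hX.1.eigenvalues i - Real.exp (θ * hX.1.eigenvalues i) : ℝ) : ℂ)) * Uᴴ := by
    have h3' : g • X = g • (U * diagonal (fun i => ((hX.1.eigenvalues i : ℝ) : ℂ)) * Uᴴ) := congrArg (g • ·) h3
    rw [h4 θ, h3']
    have e1 : (1 : Matrix n n ℂ) = U * 1 * Uᴴ := by rw [mul_one, h1]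
    rw [e1, ← smul_mul_assoc, ← mul_smul_comm, ← add_mul, ← mul_add, ← sub_mul, ← mul_sub,
      ← diagonal_smul, ← diagonal_one, diagonal_add, diagonal_sub]
    congr 3
    ext i; simp
  rw [e]
  exact hlp_conj_psd U _ fun i => sub_nonneg.2 (hg _ (hX.eigenvalues_nonneg i) (hle i))

theorem hlp_sum_herm {n κ : Type*} (s : Finset κ) (H : κ → Matrix n n ℂ)
    (hH : ∀ i, (H i).IsHermitian) : (∑ i ∈ s, H i).IsHermitian := by
  unfold IsHermitian
  rw [conjTranspose_sum]
  exact Finset.sum_congr rfl fun i _ => hH i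

theorem hlp_laplace {n : Type*} [Fintype n] [DecidableEq n] [Nonempty n] {M : ℕ} (ϱ : Fin M → ℝ)
    (hϱ : ∀ i, 0 ≤ ϱ i) (H : Fin M → Matrix n n ℂ) (hH : ∀ i, (H i).IsHermitian) (q : ℝ) (hq : 0 ≤ q)
    (hE : (q • 1 - ∑ i, ϱ i • exp (H i)).PosSemidef) (N : ℕ) :
    ∑ J : Fin N → Fin M, (∏ j, ϱ (J j)) * (trace (exp (∑ j, H (J j)))).re ≤ Fintype.card n * q ^ N := by
  induction N with
  | zero => simp
  | succ N ih =>
    rw [← (Fin.consEquiv (fun _ : Fin (N+1) => Fin M)).sum_comp, Fintype.sum_prod_type_right]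
    calc _ ≤ ∑ J : Fin N → Fin M, q * ((∏ j, ϱ (J j)) * (trace (exp (∑ j, H (J j)))).re) := by
          refine Finset.sum_le_sum fun J _ => ?_
          have hS : (∑ j, H (J j)).IsHermitian := hlp_sum_herm _ _ fun j => hH (J j)
          set S := ∑ j, H (J j) with hSdef
          set p := ∏ j, ϱ (J j) with hp
          have hp0 : 0 ≤ p := Finset.prod_nonneg fun j _ => hϱ _
          have h1 : ∑ i, ϱ i * (trace (exp (H i + S))).re ≤ q * (trace (exp S)).re := by
            calc _ ≤ ∑ i, ϱ i * (trace (exp (H i) * exp S)).re :=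
                  Finset.sum_le_sum fun i _ => mul_le_mul_of_nonneg_left (hlp_GT _ _ (hH i) hS) (hϱ i)
              _ = (trace ((∑ i, ϱ i • exp (H i)) * exp S)).re := by
                  rw [Finset.sum_mul, trace_sum, Complex.re_sum]
                  refine Finset.sum_congr rfl fun i _ => ?_
                  rw [smul_mul_assoc, trace_smul, Complex.smul_re, smul_eq_mul]
              _ ≤ _ := by
                  have := hlp_tr_nonneg _ _ hE (hlp_exp_psd S hS)
                  rw [sub_mul, trace_sub, smul_mul_assoc, one_mul, trace_smul, Complex.sub_re,
                    Complex.smul_re, smul_eq_mul] at this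
                  linarith
          calc _ = p * ∑ i, ϱ i * (trace (exp (H i + S))).re := by
                rw [Finset.mul_sum]
                refine Finset.sum_congr rfl fun i _ => ?_
                simp only [Fin.consEquiv_apply, Fin.prod_univ_succ, Fin.sum_univ_succ, Fin.cons_zero, Fin.cons_succ]
                rw [← hSdef, ← hp]; ring
            _ ≤ p * (q * (trace (exp S)).re) := mul_le_mul_of_nonneg_left h1 hp0
            _ = _ := by ring
      _ ≤ q * (Fintype.card n * q ^ N) := by
          rw [← Finset.mul_sum]; exact mul_le_mul_of_nonneg_left ih hq
      _ = _ := by ring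

open Classical in
theorem hlp_tail {n : Type*} [Fintype n] [DecidableEq n] [Nonempty n] {M : ℕ} (ϱ : Fin M → ℝ)
    (hϱ : ∀ i, 0 ≤ ϱ i) (H : Fin M → Matrix n n ℂ) (hH : ∀ i, (H i).IsHermitian) (q : ℝ) (hq : 0 ≤ q)
    (hE : (q • 1 - ∑ i, ϱ i • exp (H i)).PosSemidef) (N : ℕ) :
    ∑ J : Fin N → Fin M with ¬ (-∑ j, H (J j)).PosSemidef, (∏ j, ϱ (J j)) ≤ Fintype.card n * q ^ N := by
  refine le_trans ?_ (hlp_laplace ϱ hϱ H hH q hq hE N)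
  rw [Finset.sum_filter]
  refine Finset.sum_le_sum fun J _ => ?_
  have hS : (∑ j, H (J j)).IsHermitian := hlp_sum_herm _ _ fun j => hH (J j)
  have hp0 : 0 ≤ ∏ j, ϱ (J j) := Finset.prod_nonneg fun j _ => hϱ _
  by_cases h : (-∑ j, H (J j)).PosSemidef
  · rw [if_neg (not_not.2 h)]
    exact mul_nonneg hp0 (Complex.le_def.1 (hlp_exp_psd _ hS).trace_nonneg).1
  · rw [if_pos h]
    have : 1 ≤ (trace (exp (∑ j, H (J j)))).re := by
      by_contra hc
      exact h (hlp_small _ hS (not_le.1 hc))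
    nlinarith

theorem hlp_exp_scalar {n : Type*} [Fintype n] [DecidableEq n] (X : Matrix n n ℂ) (s : ℝ) :
    exp (X + s • (1 : Matrix n n ℂ)) = Real.exp s • exp X := by
  have e : s • (1 : Matrix n n ℂ) = diagonal (fun _ => (s : ℂ)) := by
    rw [← diagonal_one, ← diagonal_smul]; congr 1; ext i; simp
  have e2 : exp (s • (1 : Matrix n n ℂ)) = Real.exp s • (1 : Matrix n n ℂ) := by
    rw [e, exp_diagonal, ← diagonal_one, ← diagonal_smul]
    congr 1
    ext i
    rw [Pi.coe_exp, ← Complex.exp_eq_exp_ℂ, ← Complex.ofReal_exp]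
    simp
  rw [Matrix.exp_add_of_commute _ _ ((Commute.one_right X).smul_right s), e2, mul_smul_comm, mul_one]

theorem hlp_psd_smul {n : Type*} [Fintype n] [DecidableEq n] (X : Matrix n n ℂ) (hX : X.PosSemidef) (s : ℝ)
    (hs : 0 ≤ s) : (s • X).PosSemidef := hX.smul hs

theorem hlp_herm_smul {n : Type*} (X : Matrix n n ℂ) (hX : X.IsHermitian) (s : ℝ) :
    (s • X).IsHermitian := hX.smul (k := s) (by simp [IsSelfAdjoint])

open Classical in
theorem hlp_side {n : Type*} [Fintype n] [DecidableEq n] [Nonempty n] {M : ℕ} (ϱ : Fin M → ℝ)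
    (hϱ : ∀ i, 0 ≤ ϱ i) (hϱ1 : ∑ i, ϱ i = 1) (X : Fin M → Matrix n n ℂ) (hX : ∀ i, (X i).PosSemidef)
    (R : ℝ) (hR : ∀ i, (trace (X i)).re ≤ R) (θ g lam m : ℝ)
    (hg : ∀ u : ℝ, 0 ≤ u → u ≤ R → Real.exp (θ * u) ≤ 1 + g * u)
    (hE : (m • 1 - g • ∑ i, ϱ i • X i).PosSemidef) (N : ℕ) (hN : 0 < N) :
    ∑ J : Fin N → Fin M with ¬ ((θ * lam) • 1 - θ • ∑ j, X (J j)).PosSemidef, (∏ j, ϱ (J j))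
      ≤ Fintype.card n * Real.exp (N * m - θ * lam) := by
  have hN' : (N : ℝ) ≠ 0 := by positivity
  set s : ℝ := -(θ * lam / N) with hs
  have key := hlp_tail ϱ hϱ (fun i => θ • X i + s • (1 : Matrix n n ℂ))
    (fun i => (hlp_herm_smul _ (hX i).1 θ).add (hlp_herm_smul _ isHermitian_one s))
    (Real.exp s * Real.exp m) (by positivity) ?_ N
  · have e1 : (Real.exp s * Real.exp m) ^ N = Real.exp (N * m - θ * lam) := by
      rw [← Real.exp_add, ← Real.exp_nat_mul]
      congr 1
      rw [hs]; field_simp; ring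
    rw [e1] at key
    have e2 : ∀ J : Fin N → Fin M, -∑ j, (θ • X (J j) + s • (1 : Matrix n n ℂ)) =
        (θ * lam) • 1 - θ • ∑ j, X (J j) := by
      intro J
      rw [Finset.sum_add_distrib, ← Finset.smul_sum, Finset.sum_const, Finset.card_univ, Fintype.card_fin,
        ← Nat.cast_smul_eq_nsmul ℝ, smul_smul]
      have : (N : ℝ) * s = -(θ * lam) := by rw [hs]; field_simp
      rw [this, neg_smul]; abel
    simp only [e2] at key
    exact key
  · have e3 : ((Real.exp s * Real.exp m) • (1 : Matrix n n ℂ) - ∑ i, ϱ i • exp (θ • X i + s • (1 : Matrix n n ℂ)))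
        = Real.exp s • (∑ i, ϱ i • (1 + g • X i - exp (θ • X i)) + (m • 1 - g • ∑ i, ϱ i • X i)
          + (Real.exp m - (m + 1)) • (1 : Matrix n n ℂ)) := by
      simp only [hlp_exp_scalar, smul_sub, smul_add, Finset.sum_add_distrib, Finset.sum_sub_distrib, Finset.smul_sum,
        ← Finset.sum_smul, hϱ1, smul_smul, sub_smul, add_smul, one_smul, mul_comm]
      abel
    rw [e3]
    refine hlp_psd_smul _ (((posSemidef_sum _ fun i _ => ?_).add hE).add ?_) _ (Real.exp_pos s).le
    · exact hlp_psd_smul _ (hlp_exp_bound _ (hX i) R (hR i) θ g hg) _ (hϱ i)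
    · exact hlp_psd_smul _ PosSemidef.one _ (sub_nonneg.2 (Real.add_one_le_exp m))

noncomputable def hlpY {n : Type*} (y : n → ℂ) : Matrix n n ℂ := vecMulVec (star y) y

theorem hlpY_psd {n : Type*} [Fintype n] (y : n → ℂ) : (hlpY y).PosSemidef :=
  posSemidef_vecMulVec_star_self y

theorem hlpY_quad {n : Type*} [Fintype n] (y c : n → ℂ) :
    star c ⬝ᵥ (hlpY y *ᵥ c) = ((‖∑ k, c k * y k‖ ^ 2 : ℝ) : ℂ) := by
  have e : y ⬝ᵥ c = ∑ k, c k * y k := by simp [dotProduct, mul_comm]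
  have e2 : star c ⬝ᵥ star y = star (∑ k, c k * y k) := by
    simp [dotProduct, star_sum]
  rw [hlpY, vecMulVec_mulVec, dotProduct_smul, e, e2]
  simp only [op_smul_eq_smul, smul_eq_mul]
  rw [mul_comm]
  have := Complex.conj_mul' (∑ k, c k * y k)
  simpa using this

theorem hlpY_trace {n : Type*} [Fintype n] (y : n → ℂ) : (trace (hlpY y)).re = ∑ k, ‖y k‖ ^ 2 := by
  simp only [hlpY, trace, diag, vecMulVec_apply, Complex.re_sum]
  refine Finset.sum_congr rfl fun k _ => ?_
  rw [Complex.sq_norm, Complex.normSq_apply]; simp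

theorem hlp_norm_quad {n : Type*} [Fintype n] (c : n → ℂ) :
    star c ⬝ᵥ c = ((∑ k, ‖c k‖ ^ 2 : ℝ) : ℂ) := by
  simp only [dotProduct, Complex.ofReal_sum]
  refine Finset.sum_congr rfl fun k _ => ?_
  have := Complex.conj_mul' (c k)
  simpa using this

theorem hlp_form {n κ : Type*} [Fintype n] [DecidableEq n] (s : Finset κ) (w : κ → ℝ) (y : κ → n → ℂ) (a b : ℝ)
    (c : n → ℂ) :
    star c ⬝ᵥ ((a • (1 : Matrix n n ℂ) - b • ∑ i ∈ s, w i • hlpY (y i)) *ᵥ c) =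
      ((a * ∑ k, ‖c k‖ ^ 2 - b * ∑ i ∈ s, w i * ‖∑ k, c k * y i k‖ ^ 2 : ℝ) : ℂ) := by
  have h : ∀ i, star c ⬝ᵥ ((w i • hlpY (y i)) *ᵥ c) = ((w i * ‖∑ k, c k * y i k‖ ^ 2 : ℝ) : ℂ) := by
    intro i
    rw [smul_mulVec, dotProduct_smul, hlpY_quad, Complex.real_smul, ← Complex.ofReal_mul]
  rw [sub_mulVec, dotProduct_sub, smul_mulVec, smul_mulVec, dotProduct_smul, dotProduct_smul, one_mulVec,
    hlp_norm_quad, sum_mulVec, dotProduct_sum, Finset.sum_congr rfl fun i _ => h i]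
  simp

theorem hlp_form_psd {n κ : Type*} [Fintype n] [DecidableEq n] (s : Finset κ) (w : κ → ℝ) (y : κ → n → ℂ) (a b : ℝ) :
    (a • (1 : Matrix n n ℂ) - b • ∑ i ∈ s, w i • hlpY (y i)).PosSemidef ↔
      ∀ c : n → ℂ, b * ∑ i ∈ s, w i * ‖∑ k, c k * y i k‖ ^ 2 ≤ a * ∑ k, ‖c k‖ ^ 2 := by
  constructor
  · intro h c
    have := h.dotProduct_mulVec_nonneg c
    rw [hlp_form] at this
    have : 0 ≤ a * ∑ k, ‖c k‖ ^ 2 - b * ∑ i ∈ s, w i * ‖∑ k, c k * y i k‖ ^ 2 := by exact_mod_cast this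
    linarith
  · intro h
    apply PosSemidef.of_dotProduct_mulVec_nonneg
    · exact (hlp_herm_smul _ isHermitian_one a).sub
        (hlp_herm_smul _ (hlp_sum_herm _ _ fun i => hlp_herm_smul _ (hlpY_psd _).1 _) b)
    · intro c
      rw [hlp_form]
      have := sub_nonneg.2 (h c)
      exact_mod_cast this

theorem hlp_chord (R s : ℝ) (hR : 0 < R) (u : ℝ) (h0 : 0 ≤ u) (h1 : u ≤ R) :
    Real.exp (s / R * u) ≤ 1 + (Real.exp s - 1) / R * u := by
  have h := convexOn_exp.2 (Set.mem_univ (0:ℝ)) (Set.mem_univ s) 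
    (show 0 ≤ 1 - u / R from sub_nonneg.2 ((div_le_one hR).2 h1)) (show 0 ≤ u / R by positivity) (by ring)
  simp only [smul_eq_mul, mul_zero, zero_add, Real.exp_zero, mul_one] at h
  have e : s / R * u = u / R * s := by ring
  rw [e]
  refine h.trans (le_of_eq ?_)
  ring

theorem hlp_num1 : Real.exp 0.4 ≤ 1.51 := by
  have h1 : (0.95 : ℝ) ≤ Real.exp (-0.05) := by
    have := Real.add_one_le_exp (-0.05 : ℝ)
    linarith
  have h2 : Real.exp 0.05 ≤ 1 / 0.95 := by
    rw [le_div_iff₀ (by norm_num)]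
    have : Real.exp 0.05 * Real.exp (-0.05) = 1 := by rw [← Real.exp_add]; norm_num
    nlinarith [Real.exp_pos 0.05]
  have h3 : Real.exp 0.4 = Real.exp 0.05 ^ 8 := by rw [← Real.exp_nat_mul]; norm_num
  rw [h3]
  exact (pow_le_pow_left₀ (Real.exp_pos _).le h2 8).trans (by norm_num)

theorem hlp_num2 : Real.exp (-0.5) ≤ 2 / 3 := by
  have h1 := Real.add_one_le_exp (0.5 : ℝ)
  have : Real.exp 0.5 * Real.exp (-0.5) = 1 := by rw [← Real.exp_add]; norm_num
  nlinarith [Real.exp_pos (-0.5)]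

open Classical in
theorem hlp_core {ι : Type*} [Fintype ι] [DecidableEq ι] [Nonempty ι]
    (M : ℕ) (y : Fin M → ι → ℂ) (ω : Fin M → ℝ) (hω : ∀ i, 0 ≤ ω i)
    (A B : ℝ) (hA : 0 < A) (hB : 0 < B)
    (hMZ : ∀ c : ι → ℂ,
      A * ∑ k, ‖c k‖ ^ 2 ≤ ∑ i, ω i * ‖∑ k, c k * y i k‖ ^ 2 ∧
      ∑ i, ω i * ‖∑ k, c k * y i k‖ ^ 2 ≤ B * ∑ k, ‖c k‖ ^ 2)
    (C : ℝ) (hC0 : 0 < C)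
    (ϱ : Fin M → ℝ) (hϱ0 : ∀ i, 0 ≤ ϱ i) (hϱ1 : ∑ i, ϱ i = 1)
    (hϱ : ∀ i, C * (ω i * ∑ k, ‖y i k‖ ^ 2) / (∑ j, ω j * ∑ k, ‖y j k‖ ^ 2) ≤ ϱ i)
    (t : ℝ) (ht : 0 < t) (n : ℕ)
    (hn : 12 * B / (A * C) * (Fintype.card ι) * (Real.log (Fintype.card ι) + t) ≤ n) :
    ∑ J : Fin n → Fin M with ¬ (∀ c : ι → ℂ,
        A / 2 * ∑ k, ‖c k‖ ^ 2 ≤ ∑ j : Fin n, ω (J j) / (n * ϱ (J j)) * ‖∑ k, c k * y (J j) k‖ ^ 2 ∧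
        ∑ j : Fin n, ω (J j) / (n * ϱ (J j)) * ‖∑ k, c k * y (J j) k‖ ^ 2 ≤ 3 * B / 2 * ∑ k, ‖c k‖ ^ 2),
      ∏ j, ϱ (J j) ≤ 2 * Real.exp (-t) := by
  set d : ℝ := (Fintype.card ι : ℝ) with hd
  have hd1 : 1 ≤ d := by rw [hd]; exact_mod_cast Fintype.card_pos
  have hlog : 0 ≤ Real.log d := Real.log_nonneg hd1
  have hnpos : (0:ℝ) < n := lt_of_lt_of_le (by positivity) hn
  have hn0 : 0 < n := by exact_mod_cast hnpos
  -- the trace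
  set T : ℝ := ∑ j, ω j * ∑ k, ‖y j k‖ ^ 2 with hT
  have hTsum : T = ∑ k, ∑ i, ω i * ‖∑ l, (Pi.single k 1 : ι → ℂ) l * y i l‖ ^ 2 := by
    rw [hT, Finset.sum_comm]
    refine Finset.sum_congr rfl fun i _ => ?_
    rw [Finset.mul_sum]
    refine Finset.sum_congr rfl fun k _ => ?_
    simp [Pi.single_apply]
  have hsing : ∀ k : ι, ∑ l, ‖(Pi.single k 1 : ι → ℂ) l‖ ^ 2 = 1 := by
    intro k
    rw [Finset.sum_eq_single k]
    · simp
    · intro b _ hb; simp [hb]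
    · simp
  have hTB : T ≤ B * d := by
    rw [hTsum]
    refine (Finset.sum_le_sum fun k _ => (hMZ (Pi.single k 1)).2).trans (le_of_eq ?_)
    simp only [hsing, mul_one, Finset.sum_const, nsmul_eq_mul, Finset.card_univ]
    rw [← hd]; ring
  have hTA : A * d ≤ T := by
    rw [hTsum]
    refine le_trans (le_of_eq ?_) (Finset.sum_le_sum fun k _ => (hMZ (Pi.single k 1)).1)
    simp only [hsing, mul_one, Finset.sum_const, nsmul_eq_mul, Finset.card_univ]
    rw [← hd]; ring
  have hTpos : 0 < T := lt_of_lt_of_le (by positivity) hTA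
  have hAB : A ≤ B := by
    have := hTA.trans hTB
    exact le_of_mul_le_mul_right this (by linarith)
  have hzero : ∀ i, ϱ i = 0 → ω i = 0 ∨ ∀ k, y i k = 0 := by
    intro i hi
    have h1 := hϱ i
    rw [hi, div_le_iff₀ hTpos, zero_mul] at h1
    have h2 : 0 ≤ ∑ k, ‖y i k‖ ^ 2 := by positivity
    rcases (hω i).eq_or_lt with h | h
    · exact Or.inl h.symm
    · right
      have h3 : ∑ k, ‖y i k‖ ^ 2 = 0 := by
        by_contra hc
        have : 0 < ∑ k, ‖y i k‖ ^ 2 := lt_of_le_of_ne h2 (Ne.symm hc)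
        have : 0 < C * (ω i * ∑ k, ‖y i k‖ ^ 2) := by positivity
        linarith
      intro k
      have := (Finset.sum_eq_zero_iff_of_nonneg (fun k _ => by positivity)).1 h3 k (Finset.mem_univ k)
      simpa using this
  set w : Fin M → ℝ := fun i => ω i / (n * ϱ i) with hw
  have hw0 : ∀ i, 0 ≤ w i := fun i => div_nonneg (hω i) (mul_nonneg hnpos.le (hϱ0 i))
  have hwϱ : ∀ i (c : ι → ℂ), ϱ i * w i * ‖∑ k, c k * y i k‖ ^ 2 = (1 / n) * (ω i * ‖∑ k, c k * y i k‖ ^ 2) := by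
    intro i c
    by_cases h : ϱ i = 0
    · rcases hzero i h with h' | h'
      · simp [h, h']
      · simp [h']
    · simp only [hw]; field_simp
  have hsum : ∀ c : ι → ℂ, ∑ i, ϱ i * w i * ‖∑ k, c k * y i k‖ ^ 2 = (1 / n) * ∑ i, ω i * ‖∑ k, c k * y i k‖ ^ 2 := by
    intro c
    rw [Finset.mul_sum]
    exact Finset.sum_congr rfl fun i _ => hwϱ i c
  set R : ℝ := B * d / (n * C) with hRdef
  have hR : 0 < R := by positivity
  have htr : ∀ i, (trace (w i • hlpY (y i))).re ≤ R := by
    intro i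
    rw [trace_smul, Complex.smul_re, hlpY_trace, smul_eq_mul]
    by_cases h : ϱ i = 0
    · simp only [hw, h]; simp [hR.le]
    · have hpos : 0 < ϱ i := lt_of_le_of_ne (hϱ0 i) (Ne.symm h)
      have h1 := hϱ i
      rw [div_le_iff₀ hTpos] at h1
      simp only [hw]
      rw [hRdef, div_mul_eq_mul_div, div_le_div_iff₀ (by positivity) (by positivity)]
      have h2 : ϱ i * T ≤ ϱ i * (B * d) := mul_le_mul_of_nonneg_left hTB hpos.le
      nlinarith
  have hX : ∀ i, (w i • hlpY (y i)).PosSemidef := fun i => hlp_psd_smul _ (hlpY_psd _) _ (hw0 i)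
  have hARn : 12 * (Real.log d + t) ≤ A / R := by
    rw [hRdef, div_div_eq_mul_div, le_div_iff₀ (by positivity)]
    have h1 : 12 * B / (A * C) * d * (Real.log d + t) = (12 * (Real.log d + t) * (B * d)) / (A * C) := by ring
    rw [h1, div_le_iff₀ (by positivity)] at hn
    linarith
  have hBRn : A / R ≤ B / R := div_le_div_of_nonneg_right hAB hR.le
  have hfin : ∀ z : ℝ, z ≤ -(Real.log d + t) → d * Real.exp z ≤ Real.exp (-t) := by
    intro z hz
    calc d * Real.exp z ≤ d * Real.exp (-(Real.log d + t)) := by gcongr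
      _ = Real.exp (-t) := by
        rw [neg_add, Real.exp_add, Real.exp_neg (Real.log d), Real.exp_log (by linarith)]
        field_simp
  -- upper tail
  have up := hlp_side ϱ hϱ0 hϱ1 (fun i => w i • hlpY (y i)) hX R htr (0.4 / R) ((Real.exp 0.4 - 1) / R)
    (3 * B / 2) ((Real.exp 0.4 - 1) / R * (B / n)) (hlp_chord R 0.4 hR) (by
      simp only [smul_smul]
      rw [hlp_form_psd]
      intro c
      rw [hsum, mul_assoc]
      have h1 : 0 ≤ (Real.exp 0.4 - 1) / R := div_nonneg (sub_nonneg.2 (Real.one_le_exp (by norm_num))) hR.le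
      refine mul_le_mul_of_nonneg_left ?_ h1
      have h2 := mul_le_mul_of_nonneg_left (hMZ c).2 (show 0 ≤ 1 / (n:ℝ) by positivity)
      refine h2.trans (le_of_eq (by ring))) n hn0
  have lo := hlp_side ϱ hϱ0 hϱ1 (fun i => w i • hlpY (y i)) hX R htr (-0.5 / R) ((Real.exp (-0.5) - 1) / R)
    (A / 2) ((Real.exp (-0.5) - 1) / R * (A / n)) (hlp_chord R (-0.5) hR) (by
      simp only [smul_smul]
      rw [hlp_form_psd]
      intro c
      rw [hsum, mul_assoc]
      have h1 : (Real.exp (-0.5) - 1) / R ≤ 0 := by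
        refine div_nonpos_of_nonpos_of_nonneg ?_ hR.le
        have := hlp_num2; linarith
      refine mul_le_mul_of_nonpos_left ?_ h1
      have h2 := mul_le_mul_of_nonneg_left (hMZ c).1 (show 0 ≤ 1 / (n:ℝ) by positivity)
      refine le_trans (le_of_eq (by ring)) h2) n hn0
  have up2 := up.trans (hfin _ (by
    have e : (n:ℝ) * ((Real.exp 0.4 - 1) / R * (B / n)) - 0.4 / R * (3 * B / 2) = (B / R) * (Real.exp 0.4 - 1.6) := by
      field_simp; ring
    rw [e]
    have h1 : 0 ≤ B / R := by positivity
    have := hlp_num1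
    nlinarith))
  have lo2 := lo.trans (hfin _ (by
    have e : (n:ℝ) * ((Real.exp (-0.5) - 1) / R * (A / n)) - -0.5 / R * (A / 2) = (A / R) * (Real.exp (-0.5) - 0.75) := by
      field_simp; ring
    rw [e]
    have h1 : 0 ≤ A / R := by positivity
    have := hlp_num2
    nlinarith))
  rw [two_mul]
  refine le_trans ?_ (add_le_add up2 lo2)
  rw [Finset.sum_filter, Finset.sum_filter, Finset.sum_filter, ← Finset.sum_add_distrib]
  refine Finset.sum_le_sum fun J _ => ?_
  have hp0 : 0 ≤ ∏ j, ϱ (J j) := Finset.prod_nonneg fun j _ => hϱ0 _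
  by_cases hu : ((0.4 / R * (3 * B / 2)) • (1 : Matrix ι ι ℂ) - (0.4 / R) • ∑ j, w (J j) • hlpY (y (J j))).PosSemidef
  · by_cases hl : ((-0.5 / R * (A / 2)) • (1 : Matrix ι ι ℂ) - (-0.5 / R) • ∑ j, w (J j) • hlpY (y (J j))).PosSemidef
    · rw [if_neg (not_not.2 hu), if_neg (not_not.2 hl), if_neg]
      · simp
      · rw [not_not]
        intro c
        have h1 := (hlp_form_psd Finset.univ (fun j => w (J j)) (fun j => y (J j)) _ _).1 hu c
        have h2 := (hlp_form_psd Finset.univ (fun j => w (J j)) (fun j => y (J j)) _ _).1 hl c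
        rw [mul_assoc] at h1 h2
        refine ⟨?_, le_of_mul_le_mul_left h1 (by positivity)⟩
        refine le_of_mul_le_mul_left ?_ (show 0 < 0.5 / R by positivity)
        have e : -0.5 / R = -(0.5 / R) := by ring
        rw [e] at h2
        linarith
    · rw [if_pos hl]
      split_ifs <;> linarith
  · rw [if_pos hu]
    split_ifs <;> linarith

open MeasureTheory

theorem hlp_integrable {D : Type*} [MeasurableSpace D] (ν : Measure D)
    {ι : Type*} [Fintype ι] [DecidableEq ι] [Nonempty ι] (η : ι → D → ℂ)
    (horth : ∀ k l : ι, ∫ y, η k y * (starRingEnd ℂ) (η l y) ∂ν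
      = if k = l then 1 else 0)
    (M : ℕ) (x : Fin M → D) (ω : Fin M → ℝ) (hω : ∀ i, 0 ≤ ω i)
    (A B : ℝ) (hA : 0 < A)
    (hMZ : ∀ c : ι → ℂ,
      A * ∫ y, ‖∑ k, c k * η k y‖ ^ 2 ∂ν ≤ ∑ i, ω i * ‖∑ k, c k * η k (x i)‖ ^ 2 ∧
      ∑ i, ω i * ‖∑ k, c k * η k (x i)‖ ^ 2 ≤ B * ∫ y, ‖∑ k, c k * η k y‖ ^ 2 ∂ν) (c : ι → ℂ) :
    Integrable (fun y => ‖∑ k, c k * η k y‖ ^ 2) ν := by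
  have h1 : ∀ c : ι → ℂ, ∑ i, ω i * ‖∑ k, c k * η k (x i)‖ ^ 2 ≠ 0 →
      Integrable (fun y => ‖∑ k, c k * η k y‖ ^ 2) ν := by
    intro c hc
    by_contra hni
    have h := (hMZ c).2
    rw [integral_undef hni, mul_zero] at h
    exact hc (le_antisymm h (Finset.sum_nonneg fun i _ => mul_nonneg (hω i) (by positivity)))
  by_cases hc : ∑ i, ω i * ‖∑ k, c k * η k (x i)‖ ^ 2 = 0
  swap
  · exact h1 c hc
  obtain ⟨k0⟩ := (inferInstance : Nonempty ι)
  set v : ι → ℂ := Pi.single k0 1 with hv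
  have hvs : ∀ z, ∑ k, v k * η k z = η k0 z := by
    intro z; simp [hv, Pi.single_apply]
  have hvpos : 0 < ∑ i, ω i * ‖∑ k, v k * η k (x i)‖ ^ 2 := by
    have h := (hMZ v).1
    have e : ∫ y, ‖∑ k, v k * η k y‖ ^ 2 ∂ν = 1 := by
      have h2 := horth k0 k0
      simp only [if_true, Complex.mul_conj'] at h2
      simp only [hvs]
      have h3 : ∫ y, ((‖η k0 y‖ ^ 2 : ℝ) : ℂ) ∂ν = 1 := by
        rw [← h2]; congr 1; ext y; push_cast; rfl
      rw [integral_complex_ofReal] at h3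
      exact_mod_cast h3
    rw [e] at h
    linarith
  have hz : ∀ i, ω i = 0 ∨ ∑ k, c k * η k (x i) = 0 := by
    intro i
    have := (Finset.sum_eq_zero_iff_of_nonneg (fun i _ => mul_nonneg (hω i) (by positivity))).1 hc i (Finset.mem_univ i)
    simpa using this
  have ep : ∑ i, ω i * ‖∑ k, (c + v) k * η k (x i)‖ ^ 2 = ∑ i, ω i * ‖∑ k, v k * η k (x i)‖ ^ 2 := by
    refine Finset.sum_congr rfl fun i _ => ?_
    rcases hz i with h | h
    · simp [h]
    · simp only [Pi.add_apply, add_mul, Finset.sum_add_distrib, h, zero_add]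
  have em : ∑ i, ω i * ‖∑ k, (c - v) k * η k (x i)‖ ^ 2 = ∑ i, ω i * ‖∑ k, v k * η k (x i)‖ ^ 2 := by
    refine Finset.sum_congr rfl fun i _ => ?_
    rcases hz i with h | h
    · simp [h]
    · simp only [Pi.sub_apply, sub_mul, Finset.sum_sub_distrib, h, zero_sub, norm_neg]
  have i1 := h1 v hvpos.ne'
  have i2 := h1 (c + v) (by rw [ep]; exact hvpos.ne')
  have i3 := h1 (c - v) (by rw [em]; exact hvpos.ne')
  refine (((i2.add i3).const_mul (1/2)).sub i1).congr (Filter.Eventually.of_forall fun z => ?_)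
  have := parallelogram_law_with_norm ℝ (∑ k, c k * η k z) (∑ k, v k * η k z)
  simp only [Pi.add_apply, Pi.sub_apply, add_mul, sub_mul, Finset.sum_add_distrib, Finset.sum_sub_distrib]
  nlinarith

theorem hlp_polar (a b : ℂ) : a * (starRingEnd ℂ) b = (1 / 4 : ℂ) * (((‖a + b‖ ^ 2 : ℝ) : ℂ) - ((‖a - b‖ ^ 2 : ℝ) : ℂ)
    + Complex.I * (((‖a + Complex.I * b‖ ^ 2 : ℝ) : ℂ) - ((‖a - Complex.I * b‖ ^ 2 : ℝ) : ℂ))) := by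
  simp only [Complex.sq_norm, Complex.normSq_apply]
  apply Complex.ext
  · simp; ring
  · simp; ring

theorem hlp_norm {D : Type*} [MeasurableSpace D] (ν : Measure D)
    {ι : Type*} [Fintype ι] [DecidableEq ι] (η : ι → D → ℂ)
    (horth : ∀ k l : ι, ∫ y, η k y * (starRingEnd ℂ) (η l y) ∂ν
      = if k = l then 1 else 0)
    (hint : ∀ c : ι → ℂ, Integrable (fun y => ‖∑ k, c k * η k y‖ ^ 2) ν) (c : ι → ℂ) :
    ∫ y, ‖∑ k, c k * η k y‖ ^ 2 ∂ν = ∑ k, ‖c k‖ ^ 2 := by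
  have h1 : ∀ (k l : ι) (z : ℂ), Integrable (fun y => ((‖η k y + z * η l y‖ ^ 2 : ℝ) : ℂ)) ν := by
    intro k l z
    have h := (hint (Pi.single k 1 + Pi.single l z)).ofReal (𝕜 := ℂ)
    refine h.congr (Filter.Eventually.of_forall fun y => ?_)
    simp [Pi.single_apply, add_mul, Finset.sum_add_distrib]
  have h2 : ∀ k l : ι, Integrable (fun y => η k y * (starRingEnd ℂ) (η l y)) ν := by
    intro k l
    have := (((h1 k l 1).sub (h1 k l (-1))).add (((h1 k l Complex.I).sub (h1 k l (-Complex.I))).const_mul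
      Complex.I)).const_mul (1 / 4 : ℂ)
    refine this.congr (Filter.Eventually.of_forall fun y => ?_)
    simp only [Pi.add_apply, Pi.sub_apply, one_mul, neg_mul, ← sub_eq_add_neg]
    exact (hlp_polar _ _).symm
  have h3 : ((∫ y, ‖∑ k, c k * η k y‖ ^ 2 ∂ν : ℝ) : ℂ) = ((∑ k, ‖c k‖ ^ 2 : ℝ) : ℂ) := by
    rw [← integral_complex_ofReal]
    have e : ∀ y, ((‖∑ k, c k * η k y‖ ^ 2 : ℝ) : ℂ) =
        ∑ k, ∑ l, (c k * (starRingEnd ℂ) (c l)) * (η k y * (starRingEnd ℂ) (η l y)) := by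
      intro y
      have := Complex.mul_conj' (∑ k, c k * η k y)
      push_cast
      rw [← this, map_sum, Finset.sum_mul_sum]
      refine Finset.sum_congr rfl fun k _ => Finset.sum_congr rfl fun l _ => ?_
      rw [map_mul]; ring
    simp only [e]
    rw [integral_finsetSum _ fun k _ => integrable_finsetSum _ fun l _ => (h2 k l).const_mul _]
    push_cast
    refine Finset.sum_congr rfl fun k _ => ?_
    rw [integral_finsetSum _ fun l _ => (h2 k l).const_mul _]
    simp only [integral_const_mul, horth]
    simp [Complex.mul_conj']
  exact_mod_cast h3

open Classical in
theorem hlp_meas (M n : ℕ) (ϱ : Fin M → ℝ) (hϱ0 : ∀ i, 0 ≤ ϱ i) (hϱ1 : ∑ i, ϱ i = 1)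
    (P : (Fin n → Fin M) → Prop) (e : ℝ) (he : ∑ J : Fin n → Fin M with ¬ P J, ∏ j, ϱ (J j) ≤ e) :
    ENNReal.ofReal (1 - e) ≤ (Measure.pi (fun _ : Fin n =>
          (∑ i : Fin M, ENNReal.ofReal (ϱ i) • Measure.dirac i : Measure (Fin M)))) {J | P J} := by
  set μ : Measure (Fin M) := ∑ i : Fin M, ENNReal.ofReal (ϱ i) • Measure.dirac i with hμ
  have hs : ∀ i, μ {i} = ENNReal.ofReal (ϱ i) := by
    intro i
    simp [hμ, Set.indicator_apply]
  have hprob : IsProbabilityMeasure μ := by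
    constructor
    rw [hμ]
    simp only [Measure.coe_finsetSum, Finset.sum_apply, Measure.smul_apply, measure_univ, smul_eq_mul, mul_one]
    rw [← ENNReal.ofReal_sum_of_nonneg fun i _ => hϱ0 i, hϱ1, ENNReal.ofReal_one]
  have hc : (Measure.pi (fun _ : Fin n => μ)) {J | P J}ᶜ ≤ ENNReal.ofReal e := by
    have e1 : {J : Fin n → Fin M | P J}ᶜ = ((Finset.univ.filter fun J => ¬ P J : Finset (Fin n → Fin M)) : Set _) := by
      ext J; simp
    rw [e1, ← sum_measure_singleton]
    simp only [Measure.pi_singleton, hs]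
    refine le_trans (le_of_eq ?_) (ENNReal.ofReal_le_ofReal he)
    rw [ENNReal.ofReal_sum_of_nonneg fun J _ => Finset.prod_nonneg fun j _ => hϱ0 _]
    refine Finset.sum_congr rfl fun J _ => ?_
    rw [ENNReal.ofReal_prod_of_nonneg fun j _ => hϱ0 _]
  have h1 := prob_compl_eq_one_sub (μ := Measure.pi (fun _ : Fin n => μ)) (s := {J | P J}ᶜ) (Set.toFinite _).measurableSet
  rw [compl_compl] at h1
  have he0 : 0 ≤ e := le_trans (Finset.sum_nonneg fun J _ => Finset.prod_nonneg fun j _ => hϱ0 _) he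
  rw [h1, ENNReal.ofReal_sub _ he0, ENNReal.ofReal_one]
  exact tsub_le_tsub_left hc 1

end HLP

/-- Random subsampling of `L₂`-MZ points: drawing `n` points i.i.d. from `X_MZ` with
probabilities `ϱ_i` proportional (up to `C`) to the weighted Christoffel function, the
subsampled points with weights `ω_i/(n ϱ_i)` satisfy an `L₂`-MZ inequality with
constants `A/2`, `3B/2` with probability at least `1 − 2 e^{−t}`. -/
theorem stmt10 {D : Type*} [MeasurableSpace D] (ν : Measure D) [SigmaFinite ν]
    {ι : Type*} [Fintype ι] [DecidableEq ι] [Nonempty ι] (η : ι → D → ℂ)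
    (horth : ∀ k l : ι, ∫ y, η k y * (starRingEnd ℂ) (η l y) ∂ν
      = if k = l then 1 else 0)
    (M : ℕ) (x : Fin M → D) (ω : Fin M → ℝ) (hω : ∀ i, 0 ≤ ω i)
    (A B : ℝ) (hA : 0 < A) (hB : 0 < B)
    (hMZ : ∀ c : ι → ℂ,
      A * ∫ y, ‖∑ k, c k * η k y‖ ^ 2 ∂ν ≤ ∑ i, ω i * ‖∑ k, c k * η k (x i)‖ ^ 2 ∧
      ∑ i, ω i * ‖∑ k, c k * η k (x i)‖ ^ 2 ≤ B * ∫ y, ‖∑ k, c k * η k y‖ ^ 2 ∂ν)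
    (C : ℝ) (hC0 : 0 < C) (hC1 : C ≤ 1)
    (ϱ : Fin M → ℝ) (hϱ0 : ∀ i, 0 ≤ ϱ i) (hϱ1 : ∑ i, ϱ i = 1)
    (hϱ : ∀ i, C * (ω i * ∑ k, ‖η k (x i)‖ ^ 2) /
        (∑ j, ω j * ∑ k, ‖η k (x j)‖ ^ 2) ≤ ϱ i)
    (t : ℝ) (ht : 0 < t) (n : ℕ)
    (hn : 12 * B / (A * C) * (Fintype.card ι) * (Real.log (Fintype.card ι) + t) ≤ n) :
    ENNReal.ofReal (1 - 2 * Real.exp (-t)) ≤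
      (Measure.pi (fun _ : Fin n =>
          (∑ i : Fin M, ENNReal.ofReal (ϱ i) • Measure.dirac i : Measure (Fin M))))
        {J : Fin n → Fin M | ∀ c : ι → ℂ,
          A / 2 * ∫ y, ‖∑ k, c k * η k y‖ ^ 2 ∂ν
              ≤ ∑ j : Fin n, ω (J j) / (n * ϱ (J j)) * ‖∑ k, c k * η k (x (J j))‖ ^ 2 ∧
          ∑ j : Fin n, ω (J j) / (n * ϱ (J j)) * ‖∑ k, c k * η k (x (J j))‖ ^ 2
              ≤ 3 * B / 2 * ∫ y, ‖∑ k, c k * η k y‖ ^ 2 ∂ν} := by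
  have hint := hlp_integrable ν η horth M x ω hω A B hA hMZ
  have hnorm := hlp_norm ν η horth hint
  simp only [hnorm] at hMZ ⊢
  refine hlp_meas M n ϱ hϱ0 hϱ1 _ _ ?_
  exact hlp_core M (fun i k => η k (x i)) ω hω A B hA hB hMZ C hC0 ϱ hϱ0 hϱ1 hϱ t ht n hn
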